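/- arXiv:1901.01647 — 2 statements merged into one kernel-verified Lean document; each statement's English description precedes it below -/
import Mathlib

section
/- Let G be a group, let Z be a central subgroup of G, and let c, c' : G → ℝ be subadditive with c(g) ≤ c'(g) for all g ∈ G. Let σ_c, σ_{c'} denote the associated limits σ_c(g) = lim_{k→∞} c(g^k)/k and σ_{c'}(g) = lim_{k→∞} c'(g^k)/k. If σ_{c'}(φ*z) = σ_{c'}(φ) for all φ ∈ G and z ∈ Z, then also σ_c(φ*z) = σ_c(φ) for all φ ∈ G and z ∈ Z. -/
open Filter Topology

/-- The asymptotic limit of a subadditive function is subadditive on commuting pairs. -/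
theorem limit_mul_le_of_commute {G : Type*} [Group G] {c : G → ℝ}
    (hc : ∀ g h : G, c (g * h) ≤ c g + c h) {σ : G → ℝ}
    (hσ : ∀ g : G, Tendsto (fun k : ℕ => c (g ^ k) / k) atTop (𝓝 (σ g)))
    {g h : G} (hgh : Commute g h) : σ (g * h) ≤ σ g + σ h := by
  refine le_of_tendsto_of_tendsto' (hσ (g * h)) ((hσ g).add (hσ h)) fun k => ?_
  rw [hgh.mul_pow, ← add_div]
  exact div_le_div_of_nonneg_right (hc _ _) k.cast_nonneg

/-- The asymptotic limit of a real-valued function on a group vanishes at the identity. -/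
theorem limit_one_eq_zero {G : Type*} [Group G] {c : G → ℝ} {σ : G → ℝ}
    (hσ : ∀ g : G, Tendsto (fun k : ℕ => c (g ^ k) / k) atTop (𝓝 (σ g))) : σ 1 = 0 := by
  have h := hσ 1
  simp only [one_pow] at h
  exact tendsto_nhds_unique h (tendsto_const_div_atTop_nhds_zero_nat (c 1))

theorem sigma_descends_of_dominated {G : Type*} [Group G]
    (Z : Subgroup G) (hZ : Z ≤ Subgroup.center G)
    (c c' : G → ℝ)
    (hc : ∀ g h : G, c (g * h) ≤ c g + c h)
    (hc' : ∀ g h : G, c' (g * h) ≤ c' g + c' h)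
    (hle : ∀ g : G, c g ≤ c' g)
    (σ σ' : G → ℝ)
    (hσ : ∀ g : G, Filter.Tendsto (fun k : ℕ => c (g ^ k) / k) Filter.atTop (nhds (σ g)))
    (hσ' : ∀ g : G, Filter.Tendsto (fun k : ℕ => c' (g ^ k) / k) Filter.atTop (nhds (σ' g)))
    (hdesc : ∀ φ : G, ∀ z ∈ Z, σ' (φ * z) = σ' φ) :
    ∀ φ : G, ∀ z ∈ Z, σ (φ * z) = σ φ := by
  have nonpos : ∀ z ∈ Z, σ z ≤ 0 := fun z hz => by
    have hz' : σ' z = 0 := by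
      rw [← one_mul z, hdesc 1 z hz, limit_one_eq_zero hσ']
    rw [← hz']
    exact le_of_tendsto_of_tendsto' (hσ z) (hσ' z) fun k =>
      div_le_div_of_nonneg_right (hle _) k.cast_nonneg
  have mul_le : ∀ φ : G, ∀ z ∈ Z, σ (φ * z) ≤ σ φ := fun φ z hz => by
    have h := limit_mul_le_of_commute hc hσ (Subgroup.mem_center_iff.mp (hZ hz) φ)
    linarith [nonpos z hz]
  intro φ z hz
  refine le_antisymm (mul_le φ z hz) ?_
  simpa using mul_le (φ * z) z⁻¹ (Z.inv_mem hz)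
end

section
/- Let G be a group, let c : G → ℝ be subadditive, let σ_c(g) denote the limit of c(g^k)/k as k → ∞, let n be a positive integer, and let g_1, …, g_n ∈ G, a_1, …, a_n ∈ ℝ, K > 0 be such that for every index ℓ and every ψ ∈ G one has c(ψ*g_ℓ*ψ⁻¹) + a_ℓ ≤ K and c(ψ*g_ℓ⁻¹*ψ⁻¹) − a_ℓ ≤ K. Then for every φ ∈ G, |σ_c(g_1*⋯*g_n*φ) − σ_c(φ) + (a_1 + ⋯ + a_n)| ≤ n·K. -/
open Filter Topology

theorem subadditive_mul_pow_le {G : Type*} [Group G] {c : G → ℝ}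
    (hc : ∀ g h : G, c (g * h) ≤ c g + c h) {f : G} {B : ℝ}
    (hf : ∀ ψ : G, c (ψ * f * ψ⁻¹) ≤ B) (φ : G) (k : ℕ) (x : G) :
    c ((f * φ) ^ k * x) ≤ c (φ ^ k * x) + k * B := by
  induction k generalizing x with
  | zero => simp
  | succ k ih =>
    have h₁ := ih (f * φ * x)
    have h₂ := hc (φ ^ k * f * (φ ^ k)⁻¹) (φ ^ (k + 1) * x)
    have h₃ : φ ^ k * f * (φ ^ k)⁻¹ * (φ ^ (k + 1) * x) = φ ^ k * (f * φ * x) := by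
      simp only [pow_succ]; group
    rw [h₃] at h₂
    rw [pow_succ, mul_assoc]
    push_cast
    linarith [hf (φ ^ k)]

theorem homogenization_mul_le {G : Type*} [Group G] {c : G → ℝ}
    (hc : ∀ g h : G, c (g * h) ≤ c g + c h) {σ : G → ℝ}
    (hσ : ∀ g : G, Tendsto (fun k : ℕ => c (g ^ k) / k) atTop (𝓝 (σ g))) {f : G} {B : ℝ}
    (hf : ∀ ψ : G, c (ψ * f * ψ⁻¹) ≤ B) (φ : G) :
    σ (f * φ) ≤ σ φ + B := by
  refine le_of_tendsto_of_tendsto (hσ (f * φ)) ((hσ φ).add_const B) ?_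
  filter_upwards [eventually_gt_atTop 0] with k hk
  have hk' : (0 : ℝ) < k := by exact_mod_cast hk
  have h := subadditive_mul_pow_le hc hf φ k 1
  simp only [mul_one] at h
  rw [div_add' _ _ _ hk'.ne']
  gcongr
  linarith

theorem homogenization_defect {G : Type*} [Group G] {c : G → ℝ}
    (hc : ∀ g h : G, c (g * h) ≤ c g + c h) {σ : G → ℝ}
    (hσ : ∀ g : G, Tendsto (fun k : ℕ => c (g ^ k) / k) atTop (𝓝 (σ g))) {f : G} {a K : ℝ}
    (h1 : ∀ ψ : G, c (ψ * f * ψ⁻¹) + a ≤ K) (h2 : ∀ ψ : G, c (ψ * f⁻¹ * ψ⁻¹) - a ≤ K) (φ : G) :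
    |σ (f * φ) - σ φ + a| ≤ K := by
  have hupper := homogenization_mul_le hc hσ (fun ψ => le_sub_iff_add_le.2 (h1 ψ)) φ
  have hlower := homogenization_mul_le hc hσ (fun ψ => sub_le_iff_le_add.1 (h2 ψ)) (f * φ)
  rw [inv_mul_cancel_left] at hlower
  rw [abs_le]
  constructor <;> linarith

theorem sigma_defect_iterated {G : Type*} [Group G]
    (c : G → ℝ)
    (hc : ∀ g h : G, c (g * h) ≤ c g + c h)
    (σ : G → ℝ)
    (hσ : ∀ g : G, Filter.Tendsto (fun k : ℕ => c (g ^ k) / k) Filter.atTop (nhds (σ g)))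
    (n : ℕ) (hn : 0 < n)
    (g : Fin n → G) (a : Fin n → ℝ) (K : ℝ) (hK : 0 < K)
    (h1 : ∀ (ℓ : Fin n) (ψ : G), c (ψ * g ℓ * ψ⁻¹) + a ℓ ≤ K)
    (h2 : ∀ (ℓ : Fin n) (ψ : G), c (ψ * (g ℓ)⁻¹ * ψ⁻¹) - a ℓ ≤ K) :
    ∀ φ : G, |σ ((List.ofFn g).prod * φ) - σ φ + ∑ ℓ, a ℓ| ≤ (n : ℝ) * K := by
  clear hn
  intro φ
  induction n with
  | zero => simp
  | succ n ih =>
    have htail := ih (fun i => g i.succ) (fun i => a i.succ) (fun i => h1 i.succ)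
      (fun i => h2 i.succ)
    have hhead := homogenization_defect hc hσ (h1 0) (h2 0)
      ((List.ofFn fun i => g i.succ).prod * φ)
    rw [List.ofFn_succ, List.prod_cons, mul_assoc, Fin.sum_univ_succ]
    push_cast
    rw [abs_le] at *
    constructor <;> linarith
end
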